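/- Let Ω ⊂ ℂⁿ be a smooth bounded pseudoconvex domain with smooth defining function ρ, and let K ⊆ bΩ be compact. Suppose that for every P ∈ K the complex Hessian L_ρ(P) is positive semidefinite on the complex linear span S(P) of N(P) and L_n(P) (i.e., L_ρ(w, w̄)(P) ≥ 0 for all w ∈ S(P)). Then there exists a smooth defining function ρ̃ of Ω such that L_{ρ̃}(ζ, w̄)(P) = 0 for all ζ, w ∈ S(P) and all P ∈ K; that is, the complex Hessian of ρ̃ vanishes identically on the span of the Levi null space and the complex normal at every point of K. -/

import Mathlib

open Complex BigOperators

noncomputable section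

/-- The Wirtinger derivative `∂f/∂z_j` of `f : ℂⁿ → ℂ` at `z`:
`(1/2)(∂f/∂x_j − i ∂f/∂y_j)`, where the real directional derivatives are taken in the
directions `e_j` and `i·e_j` respectively. -/
def wDz (n : ℕ) (f : (Fin n → ℂ) → ℂ) (j : Fin n) (z : Fin n → ℂ) : ℂ :=
  (1 / 2 : ℂ) *
    (fderiv ℝ f z (Pi.single j 1) - Complex.I * fderiv ℝ f z (Pi.single j Complex.I))

/-- The Wirtinger derivative `∂f/∂z̄_j` of `f : ℂⁿ → ℂ` at `z`:
`(1/2)(∂f/∂x_j + i ∂f/∂y_j)`. -/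
def wDzbar (n : ℕ) (f : (Fin n → ℂ) → ℂ) (j : Fin n) (z : Fin n → ℂ) : ℂ :=
  (1 / 2 : ℂ) *
    (fderiv ℝ f z (Pi.single j 1) + Complex.I * fderiv ℝ f z (Pi.single j Complex.I))

/-- A real-valued function on `ℂⁿ` viewed as complex-valued. -/
def cplx (n : ℕ) (ρ : (Fin n → ℂ) → ℝ) : (Fin n → ℂ) → ℂ := fun z => (ρ z : ℂ)

/-- The complex Hessian (Levi form) `L_ρ(ζ, w̄)(P) = Σ_{j,k} ∂²ρ/∂z_j∂z̄_k (P) ζ_j w̄_k`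
of a real-valued function `ρ`. -/
def levi (n : ℕ) (ρ : (Fin n → ℂ) → ℝ) (P : Fin n → ℂ) (ζ w : Fin n → ℂ) : ℂ :=
  ∑ j, ∑ k,
    wDzbar n (fun z => wDz n (cplx n ρ) j z) k P * ζ j * (starRingEnd ℂ) (w k)

/-- The squared Euclidean norm of the real gradient of a real-valued function `ρ` on `ℂⁿ`:
`|∇ρ|² = 4 Σ_j |∂ρ/∂z_j|²`. -/
def gradSq (n : ℕ) (ρ : (Fin n → ℂ) → ℝ) (z : Fin n → ℂ) : ℝ :=
  4 * ∑ j, Complex.normSq (wDz n (cplx n ρ) j z)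

/-- The squared Euclidean norm `|w|²` of a vector `w ∈ ℂⁿ`. -/
def vnormSq (n : ℕ) (w : Fin n → ℂ) : ℝ := ∑ j, Complex.normSq (w j)

/-- The complex tangent space `T^{1,0}_P(bΩ) = {ζ : Σ_j ζ_j ∂ρ/∂z_j (P) = 0}`. -/
def cTangent (n : ℕ) (ρ : (Fin n → ℂ) → ℝ) (P : Fin n → ℂ) : Set (Fin n → ℂ) :=
  {ζ | ∑ j, ζ j * wDz n (cplx n ρ) j P = 0}

/-- The null space `N(P)` of the Levi form at `P`. -/
def leviNull (n : ℕ) (ρ : (Fin n → ℂ) → ℝ) (P : Fin n → ℂ) : Set (Fin n → ℂ) :=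
  {ζ | ζ ∈ cTangent n ρ P ∧ levi n ρ P ζ ζ = 0}

/-- The complex normal `L_n(P)`, the vector with `j`-th coefficient
`(2/|∇ρ|²) ∂ρ/∂z̄_j (P)`. -/
def cNormal (n : ℕ) (ρ : (Fin n → ℂ) → ℝ) (P : Fin n → ℂ) : Fin n → ℂ :=
  fun j => ((2 / gradSq n ρ P : ℝ) : ℂ) * wDzbar n (cplx n ρ) j P

/-- The complex linear span of `N(P)` and `L_n(P)`. -/
def nullNormalSpan (n : ℕ) (ρ : (Fin n → ℂ) → ℝ) (P : Fin n → ℂ) :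
    Submodule ℂ (Fin n → ℂ) :=
  Submodule.span ℂ (leviNull n ρ P ∪ {cNormal n ρ P})

/-- `ρ` is a smooth defining function for the domain `Ω`: it is smooth, `Ω = {ρ < 0}` and
`bΩ = {ρ = 0}` within a neighborhood `U` of the closure of `Ω`, and `∇ρ ≠ 0` on `bΩ`. -/
def IsDefining (n : ℕ) (Ω : Set (Fin n → ℂ)) (ρ : (Fin n → ℂ) → ℝ) : Prop :=
  ContDiff ℝ (⊤ : ℕ∞) ρ ∧
  ∃ U : Set (Fin n → ℂ), IsOpen U ∧ closure Ω ⊆ U ∧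
    Ω = {z | z ∈ U ∧ ρ z < 0} ∧
    frontier Ω = {z | z ∈ U ∧ ρ z = 0} ∧
    ∀ z ∈ frontier Ω, fderiv ℝ ρ z ≠ 0

/-- `Ω` (with defining function `ρ`) is pseudoconvex: the Levi form of `ρ` is positive
semidefinite on the complex tangent space at every boundary point. -/
def Pseudoconvex (n : ℕ) (Ω : Set (Fin n → ℂ)) (ρ : (Fin n → ℂ) → ℝ) : Prop :=
  ∀ P ∈ frontier Ω, ∀ ζ ∈ cTangent n ρ P, 0 ≤ (levi n ρ P ζ ζ).re

section Wirtinger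

variable {n : ℕ}

lemma wDz_mul {f g : (Fin n → ℂ) → ℂ} {z : Fin n → ℂ} (hf : DifferentiableAt ℝ f z)
    (hg : DifferentiableAt ℝ g z) (j : Fin n) :
    wDz n (fun z => f z * g z) j z = f z * wDz n g j z + g z * wDz n f j z := by
  simp only [wDz, fderiv_fun_mul hf hg, add_apply,
    smul_apply, smul_eq_mul]
  ring

lemma wDzbar_mul {f g : (Fin n → ℂ) → ℂ} {z : Fin n → ℂ} (hf : DifferentiableAt ℝ f z)
    (hg : DifferentiableAt ℝ g z) (j : Fin n) :
    wDzbar n (fun z => f z * g z) j z = f z * wDzbar n g j z + g z * wDzbar n f j z := by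
  simp only [wDzbar, fderiv_fun_mul hf hg, add_apply,
    smul_apply, smul_eq_mul]
  ring

lemma wDzbar_add {f g : (Fin n → ℂ) → ℂ} {z : Fin n → ℂ} (hf : DifferentiableAt ℝ f z)
    (hg : DifferentiableAt ℝ g z) (j : Fin n) :
    wDzbar n (fun z => f z + g z) j z = wDzbar n f j z + wDzbar n g j z := by
  simp only [wDzbar, fderiv_fun_add hf hg, add_apply]
  ring

lemma wDz_cexp {f : (Fin n → ℂ) → ℂ} {z : Fin n → ℂ} (hf : DifferentiableAt ℝ f z)
    (j : Fin n) :
    wDz n (fun z => Complex.exp (f z)) j z = Complex.exp (f z) * wDz n f j z := by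
  simp only [wDz, hf.hasFDerivAt.cexp.fderiv, smul_apply, smul_eq_mul]
  ring

lemma wDzbar_cexp {f : (Fin n → ℂ) → ℂ} {z : Fin n → ℂ} (hf : DifferentiableAt ℝ f z)
    (j : Fin n) :
    wDzbar n (fun z => Complex.exp (f z)) j z = Complex.exp (f z) * wDzbar n f j z := by
  simp only [wDzbar, hf.hasFDerivAt.cexp.fderiv, smul_apply, smul_eq_mul]
  ring

lemma contDiff_fderiv_apply {f : (Fin n → ℂ) → ℂ} (hf : ContDiff ℝ (⊤ : ℕ∞) f)
    (v : Fin n → ℂ) : ContDiff ℝ (⊤ : ℕ∞) (fun z => fderiv ℝ f z v) :=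
  (hf.fderiv_right (m := (⊤ : ℕ∞)) (by simp)).clm_apply contDiff_const

lemma contDiff_wDz {f : (Fin n → ℂ) → ℂ} (hf : ContDiff ℝ (⊤ : ℕ∞) f) (j : Fin n) :
    ContDiff ℝ (⊤ : ℕ∞) (wDz n f j) :=
  contDiff_const.mul ((contDiff_fderiv_apply hf _).sub
    (contDiff_const.mul (contDiff_fderiv_apply hf _)))

lemma contDiff_wDzbar {f : (Fin n → ℂ) → ℂ} (hf : ContDiff ℝ (⊤ : ℕ∞) f) (j : Fin n) :
    ContDiff ℝ (⊤ : ℕ∞) (wDzbar n f j) :=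
  contDiff_const.mul ((contDiff_fderiv_apply hf _).add
    (contDiff_const.mul (contDiff_fderiv_apply hf _)))

lemma contDiff_cplx {ρ : (Fin n → ℂ) → ℝ} (hρ : ContDiff ℝ (⊤ : ℕ∞) ρ) :
    ContDiff ℝ (⊤ : ℕ∞) (cplx n ρ) :=
  Complex.ofRealCLM.contDiff.comp hρ

lemma fderiv_cplx_apply {ρ : (Fin n → ℂ) → ℝ} {z : Fin n → ℂ} (hρ : DifferentiableAt ℝ ρ z)
    (v : Fin n → ℂ) : fderiv ℝ (cplx n ρ) z v = (fderiv ℝ ρ z v : ℂ) := by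
  have h : HasFDerivAt (cplx n ρ) (Complex.ofRealCLM.comp (fderiv ℝ ρ z)) z :=
    Complex.ofRealCLM.hasFDerivAt.comp z hρ.hasFDerivAt
  rw [h.fderiv]
  simp

lemma conj_wDz_cplx {ρ : (Fin n → ℂ) → ℝ} {z : Fin n → ℂ} (hρ : DifferentiableAt ℝ ρ z)
    (j : Fin n) :
    (starRingEnd ℂ) (wDz n (cplx n ρ) j z) = wDzbar n (cplx n ρ) j z := by
  simp [wDz, wDzbar, fderiv_cplx_apply hρ, Complex.conj_ofNat]

lemma fderiv_fderiv_apply_comm {f : (Fin n → ℂ) → ℂ} (hf : ContDiff ℝ (⊤ : ℕ∞) f)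
    (z v w : Fin n → ℂ) :
    fderiv ℝ (fun z => fderiv ℝ f z v) z w = fderiv ℝ (fun z => fderiv ℝ f z w) z v := by
  have hd : DifferentiableAt ℝ (fderiv ℝ f) z :=
    ((hf.fderiv_right (m := (⊤ : ℕ∞)) (by simp)).differentiable (by simp)).differentiableAt
  have hs : IsSymmSndFDerivAt ℝ f z :=
    hf.contDiffAt.isSymmSndFDerivAt (by
      simpa using WithTop.coe_le_coe.mpr (le_top : (2 : ℕ∞) ≤ ⊤))
  have key (u : Fin n → ℂ) : fderiv ℝ (fun z => fderiv ℝ f z u) z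
      = (fderiv ℝ (fderiv ℝ f) z).flip u := by
    rw [fderiv_clm_apply hd (differentiableAt_const u)]
    ext
    simp
  rw [key, key]
  exact hs.eq w v

lemma fderiv_wDz_apply {f : (Fin n → ℂ) → ℂ} (hf : ContDiff ℝ (⊤ : ℕ∞) f) (j : Fin n)
    (z v : Fin n → ℂ) :
    fderiv ℝ (wDz n f j) z v = (1 / 2 : ℂ) *
      (fderiv ℝ (fun z => fderiv ℝ f z (Pi.single j 1)) z v
        - Complex.I * fderiv ℝ (fun z => fderiv ℝ f z (Pi.single j Complex.I)) z v) := by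
  have hd (u : Fin n → ℂ) : DifferentiableAt ℝ (fun z => fderiv ℝ f z u) z :=
    ((contDiff_fderiv_apply hf u).differentiable (by simp)).differentiableAt
  have h := (((hd (Pi.single j 1)).hasFDerivAt).sub
    (((hd (Pi.single j Complex.I)).hasFDerivAt).const_mul Complex.I)).const_mul (1 / 2 : ℂ)
  have h' := h.fderiv
  change fderiv ℝ (wDz n f j) z = _ at h'
  rw [h']
  simp

lemma conj_wDzbar_wDz_cplx {ρ : (Fin n → ℂ) → ℝ} (hρ : ContDiff ℝ (⊤ : ℕ∞) ρ)
    (j k : Fin n) (z : Fin n → ℂ) :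
    (starRingEnd ℂ) (wDzbar n (fun z => wDz n (cplx n ρ) j z) k z)
      = wDzbar n (fun z => wDz n (cplx n ρ) k z) j z := by
  have hc := contDiff_cplx hρ
  have hreal (u v : Fin n → ℂ) :
      (starRingEnd ℂ) (fderiv ℝ (fun z => fderiv ℝ (cplx n ρ) z u) z v)
        = fderiv ℝ (fun z => fderiv ℝ (cplx n ρ) z u) z v := by
    have hd : DifferentiableAt ℝ (fun z => fderiv ℝ ρ z u) z :=
      (((hρ.fderiv_right (m := (⊤ : ℕ∞)) (by simp)).clm_apply
        contDiff_const).differentiable (by simp)).differentiableAt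
    have : (fun z => fderiv ℝ (cplx n ρ) z u) = cplx n (fun z => fderiv ℝ ρ z u) :=
      funext fun z => fderiv_cplx_apply (hρ.differentiable (by simp)).differentiableAt u
    rw [this, fderiv_cplx_apply hd, Complex.conj_ofReal]
  change (starRingEnd ℂ) (wDzbar n (wDz n (cplx n ρ) j) k z) = wDzbar n (wDz n (cplx n ρ) k) j z
  simp only [wDzbar, fderiv_wDz_apply hc, map_mul, map_add, map_sub, hreal, Complex.conj_I,
    map_div₀, map_one, map_ofNat]
  rw [fderiv_fderiv_apply_comm hc z (Pi.single j 1) (Pi.single k 1),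
    fderiv_fderiv_apply_comm hc z (Pi.single j Complex.I) (Pi.single k 1),
    fderiv_fderiv_apply_comm hc z (Pi.single j 1) (Pi.single k Complex.I),
    fderiv_fderiv_apply_comm hc z (Pi.single j Complex.I) (Pi.single k Complex.I)]
  ring

lemma wDzbar_wDz_mul_exp {ρ a : (Fin n → ℂ) → ℝ} (hρ : ContDiff ℝ (⊤ : ℕ∞) ρ)
    (ha : ContDiff ℝ (⊤ : ℕ∞) a) {P : Fin n → ℂ} (hP : ρ P = 0) (j k : Fin n) :
    wDzbar n (fun z => wDz n (cplx n fun z => ρ z * Real.exp (a z * ρ z)) j z) k P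
      = wDzbar n (fun z => wDz n (cplx n ρ) j z) k P
        + 2 * a P * wDz n (cplx n ρ) j P * (starRingEnd ℂ) (wDz n (cplx n ρ) k P) := by
  have hR := contDiff_cplx hρ
  have hA := contDiff_cplx ha
  have hAR : ContDiff ℝ (⊤ : ℕ∞) (fun z => cplx n a z * cplx n ρ z) := hA.mul hR
  have hE : ContDiff ℝ (⊤ : ℕ∞) (fun z => Complex.exp (cplx n a z * cplx n ρ z)) := hAR.cexp
  have hd {f : (Fin n → ℂ) → ℂ} (hf : ContDiff ℝ (⊤ : ℕ∞) f) (z : Fin n → ℂ) :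
      DifferentiableAt ℝ f z := (hf.differentiable (by simp)).differentiableAt
  have hprod : (cplx n fun z => ρ z * Real.exp (a z * ρ z))
      = fun z => cplx n ρ z * Complex.exp (cplx n a z * cplx n ρ z) := by
    funext z
    simp [cplx]
  have hfirst : (fun z => wDz n (cplx n fun z => ρ z * Real.exp (a z * ρ z)) j z)
      = fun z => cplx n ρ z * wDz n (fun z => Complex.exp (cplx n a z * cplx n ρ z)) j z
        + Complex.exp (cplx n a z * cplx n ρ z) * wDz n (cplx n ρ) j z := by
    funext z
    rw [hprod, wDz_mul (hd hR z) (hd hE z)]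
  have hRP : cplx n ρ P = 0 := by simp [cplx, hP]
  rw [hfirst, wDzbar_add (hd (hR.mul (contDiff_wDz hE j)) P) (hd (hE.mul (contDiff_wDz hR j)) P),
    wDzbar_mul (hd hR P) (hd (contDiff_wDz hE j) P),
    wDzbar_mul (hd hE P) (hd (contDiff_wDz hR j) P),
    wDz_cexp (hd hAR P), wDzbar_cexp (hd hAR P),
    wDz_mul (hd hA P) (hd hR P), wDzbar_mul (hd hA P) (hd hR P),
    conj_wDz_cplx (hρ.differentiable (by simp)).differentiableAt, hRP]
  simp only [cplx, mul_zero, Complex.exp_zero]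
  ring

end Wirtinger

section Levi

variable {n : ℕ} {ρ : (Fin n → ℂ) → ℝ} {P : Fin n → ℂ}

lemma levi_add_left (ζ ζ' w : Fin n → ℂ) :
    levi n ρ P (ζ + ζ') w = levi n ρ P ζ w + levi n ρ P ζ' w := by
  simp only [levi, Pi.add_apply, mul_add, add_mul, Finset.sum_add_distrib]

lemma levi_smul_left (c : ℂ) (ζ w : Fin n → ℂ) :
    levi n ρ P (c • ζ) w = c * levi n ρ P ζ w := by
  simp only [levi, Pi.smul_apply, smul_eq_mul, Finset.mul_sum]
  exact Finset.sum_congr rfl fun j _ => Finset.sum_congr rfl fun k _ => by ring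

lemma conj_levi (hρ : ContDiff ℝ (⊤ : ℕ∞) ρ) (ζ w : Fin n → ℂ) :
    (starRingEnd ℂ) (levi n ρ P ζ w) = levi n ρ P w ζ := by
  simp only [levi, map_sum, map_mul, conj_wDzbar_wDz_cplx hρ, Complex.conj_conj]
  rw [Finset.sum_comm]
  exact Finset.sum_congr rfl fun j _ => Finset.sum_congr rfl fun k _ => by ring

lemma levi_add_right (hρ : ContDiff ℝ (⊤ : ℕ∞) ρ) (ζ w w' : Fin n → ℂ) :
    levi n ρ P ζ (w + w') = levi n ρ P ζ w + levi n ρ P ζ w' := by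
  rw [← conj_levi hρ, levi_add_left, map_add, conj_levi hρ, conj_levi hρ]

lemma levi_smul_right (hρ : ContDiff ℝ (⊤ : ℕ∞) ρ) (c : ℂ) (ζ w : Fin n → ℂ) :
    levi n ρ P ζ (c • w) = (starRingEnd ℂ) c * levi n ρ P ζ w := by
  rw [← conj_levi hρ, levi_smul_left, map_mul, conj_levi hρ]

lemma levi_self_eq_re (hρ : ContDiff ℝ (⊤ : ℕ∞) ρ) (ζ : Fin n → ℂ) :
    levi n ρ P ζ ζ = ((levi n ρ P ζ ζ).re : ℂ) :=
  (Complex.conj_eq_iff_re.mp (conj_levi hρ ζ ζ)).symm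

/-- A null vector of a Hessian that is positive semidefinite on `S` is orthogonal to `S`. -/
lemma levi_eq_zero_of_self_eq_zero (hρ : ContDiff ℝ (⊤ : ℕ∞) ρ)
    {S : Submodule ℂ (Fin n → ℂ)} (hS : ∀ w ∈ S, 0 ≤ (levi n ρ P w w).re)
    {ζ w : Fin n → ℂ} (hζ : ζ ∈ S) (hw : w ∈ S) (h0 : levi n ρ P ζ ζ = 0) :
    levi n ρ P ζ w = 0 := by
  set b := levi n ρ P ζ w with hb
  set q := (levi n ρ P w w).re with hq
  have hq0 : 0 ≤ q := hS w hw
  have key (t : ℝ) : 0 ≤ 2 * t * Complex.normSq b + t ^ 2 * q * Complex.normSq b := by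
    have h := hS (ζ + ((t : ℂ) * b) • w) (S.add_mem hζ (S.smul_mem _ hw))
    have e : levi n ρ P (ζ + ((t : ℂ) * b) • w) (ζ + ((t : ℂ) * b) • w)
        = ((2 * t * Complex.normSq b + t ^ 2 * q * Complex.normSq b : ℝ) : ℂ) := by
      rw [levi_add_left, levi_add_right hρ, levi_add_right hρ, levi_smul_left, levi_smul_left,
        levi_smul_right hρ, levi_smul_right hρ, h0, ← conj_levi hρ ζ w, ← hb,
        levi_self_eq_re hρ w, ← hq]
      simp only [map_mul, Complex.conj_ofReal]
      push_cast
      rw [Complex.normSq_eq_conj_mul_self]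
      ring
    rwa [e, Complex.ofReal_re] at h
  have h := key (-(1 / (q + 1)))
  have hN := Complex.normSq_nonneg b
  by_contra hne
  have hpos : 0 < Complex.normSq b := Complex.normSq_pos.mpr hne
  have hq1 : 0 < q + 1 := by linarith
  have e : 2 * (-(1 / (q + 1))) * Complex.normSq b + (-(1 / (q + 1))) ^ 2 * q * Complex.normSq b
      = -((q + 2) * Complex.normSq b / (q + 1) ^ 2) := by
    field_simp
    ring
  rw [e] at h
  have : 0 < (q + 2) * Complex.normSq b / (q + 1) ^ 2 := by positivity
  linarith

lemma levi_mul_exp {a : (Fin n → ℂ) → ℝ} (hρ : ContDiff ℝ (⊤ : ℕ∞) ρ)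
    (ha : ContDiff ℝ (⊤ : ℕ∞) a) (hP : ρ P = 0) (ζ w : Fin n → ℂ) :
    levi n (fun z => ρ z * Real.exp (a z * ρ z)) P ζ w
      = levi n ρ P ζ w + 2 * a P * (∑ j, ζ j * wDz n (cplx n ρ) j P)
        * (starRingEnd ℂ) (∑ k, w k * wDz n (cplx n ρ) k P) := by
  simp only [levi, wDzbar_wDz_mul_exp hρ ha hP, add_mul, Finset.sum_add_distrib]
  congr 1
  rw [mul_assoc, map_sum, Finset.sum_mul_sum, Finset.mul_sum]
  refine Finset.sum_congr rfl fun j _ => ?_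
  rw [Finset.mul_sum]
  refine Finset.sum_congr rfl fun k _ => ?_
  rw [map_mul]
  ring

lemma contDiff_levi {v w : (Fin n → ℂ) → Fin n → ℂ} (hρ : ContDiff ℝ (⊤ : ℕ∞) ρ)
    (hv : ∀ j, ContDiff ℝ (⊤ : ℕ∞) fun z => v z j)
    (hw : ∀ j, ContDiff ℝ (⊤ : ℕ∞) fun z => w z j) :
    ContDiff ℝ (⊤ : ℕ∞) fun z => levi n ρ z (v z) (w z) :=
  ContDiff.sum fun j _ => ContDiff.sum fun k _ =>
    ((contDiff_wDzbar (contDiff_wDz (contDiff_cplx hρ) j) k).mul (hv j)).mul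
      (Complex.conjCLE.contDiff.comp (hw k))

lemma contDiff_gradSq (hρ : ContDiff ℝ (⊤ : ℕ∞) ρ) : ContDiff ℝ (⊤ : ℕ∞) (gradSq n ρ) := by
  have h (j : Fin n) : ContDiff ℝ (⊤ : ℕ∞) fun z => wDz n (cplx n ρ) j z :=
    contDiff_wDz (contDiff_cplx hρ) j
  have hre (j : Fin n) := Complex.reCLM.contDiff.comp (h j)
  have him (j : Fin n) := Complex.imCLM.contDiff.comp (h j)
  exact contDiff_const.mul (ContDiff.sum fun j _ =>
    ((hre j).mul (hre j)).add ((him j).mul (him j)))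

lemma gradSq_nonneg (z : Fin n → ℂ) : 0 ≤ gradSq n ρ z :=
  mul_nonneg (by norm_num) (Finset.sum_nonneg fun _ _ => Complex.normSq_nonneg _)

lemma gradSq_pos (hρ : DifferentiableAt ℝ ρ P) (h : fderiv ℝ ρ P ≠ 0) : 0 < gradSq n ρ P := by
  refine lt_of_le_of_ne (gradSq_nonneg P) fun h0 => h ?_
  have hz (j : Fin n) : wDz n (cplx n ρ) j P = 0 := by
    have h1 : ∑ j, Complex.normSq (wDz n (cplx n ρ) j P) = 0 := by
      unfold gradSq at h0
      linarith
    exact Complex.normSq_eq_zero.mp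
      ((Finset.sum_eq_zero_iff_of_nonneg fun _ _ => Complex.normSq_nonneg _).mp h1 j
        (Finset.mem_univ j))
  have hre (j : Fin n) : fderiv ℝ ρ P (Pi.single j 1) = 0 := by
    have := congrArg Complex.re (hz j)
    simpa [wDz, fderiv_cplx_apply hρ] using this
  have him (j : Fin n) : fderiv ℝ ρ P (Pi.single j Complex.I) = 0 := by
    have := congrArg Complex.im (hz j)
    simpa [wDz, fderiv_cplx_apply hρ] using this
  ext v
  have hv : v = ∑ j, ((v j).re • (Pi.single j 1 : Fin n → ℂ)
      + (v j).im • (Pi.single j Complex.I : Fin n → ℂ)) := by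
    ext i
    simp [Finset.sum_apply, Pi.single_apply, Finset.sum_add_distrib, Complex.re_add_im]
  rw [hv]
  simp [hre, him]

/-- The derivative of a defining function along its complex normal is `1/2`. -/
lemma sum_cNormal_mul_wDz (hρ : DifferentiableAt ℝ ρ P) (h : gradSq n ρ P ≠ 0) :
    ∑ j, cNormal n ρ P j * wDz n (cplx n ρ) j P = 1 / 2 := by
  have e : ∑ j, cNormal n ρ P j * wDz n (cplx n ρ) j P
      = ((2 / gradSq n ρ P * (gradSq n ρ P / 4) : ℝ) : ℂ) := by
    have : gradSq n ρ P / 4 = ∑ j, Complex.normSq (wDz n (cplx n ρ) j P) := by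
      unfold gradSq
      ring
    rw [this]
    push_cast
    rw [Finset.mul_sum]
    refine Finset.sum_congr rfl fun j _ => ?_
    rw [cNormal, ← conj_wDz_cplx hρ, Complex.normSq_eq_conj_mul_self]
    push_cast
    ring
  rw [e, show (2 / gradSq n ρ P * (gradSq n ρ P / 4) : ℝ) = 1 / 2 by field_simp; norm_num]
  norm_num

/-- There is a smooth function on `ℂⁿ` that agrees with `-2 L_ρ(L_n, L_n)` on a closed set on
which the gradient of `ρ` does not vanish. -/
lemma exists_contDiff_eq_levi_cNormal (hρ : ContDiff ℝ (⊤ : ℕ∞) ρ) {F : Set (Fin n → ℂ)}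
    (hF : IsClosed F) (hg : ∀ z ∈ F, gradSq n ρ z ≠ 0) :
    ∃ a : (Fin n → ℂ) → ℝ, ContDiff ℝ (⊤ : ℕ∞) a ∧
      ∀ z ∈ F, a z = -2 * (levi n ρ z (cNormal n ρ z) (cNormal n ρ z)).re := by
  obtain ⟨ψ, hψs, hψ, hψr⟩ := hF.isOpen_compl.exists_contDiff_support_eq (n := (⊤ : ℕ∞))
  have hψ0 (z : Fin n → ℂ) : 0 ≤ ψ z := (hψr ⟨z, rfl⟩).1
  have hzero {z : Fin n → ℂ} (hz : z ∈ F) : ψ z = 0 := by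
    by_contra hne
    exact (hψs ▸ Function.mem_support.mpr hne : z ∈ Fᶜ) hz
  have hden (z : Fin n → ℂ) : gradSq n ρ z ^ 2 + ψ z ≠ 0 := by
    by_cases hz : z ∈ F
    · rw [hzero hz, add_zero]
      exact pow_ne_zero 2 (hg z hz)
    · have h1 : ψ z ≠ 0 := Function.mem_support.mp (hψs ▸ hz)
      have h2 : 0 < ψ z := lt_of_le_of_ne (hψ0 z) h1.symm
      positivity
  have hN (j : Fin n) : ContDiff ℝ (⊤ : ℕ∞) fun z => wDzbar n (cplx n ρ) j z :=
    contDiff_wDzbar (contDiff_cplx hρ) j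
  refine ⟨fun z => -8 * (levi n ρ z (fun j => wDzbar n (cplx n ρ) j z)
      (fun j => wDzbar n (cplx n ρ) j z)).re / (gradSq n ρ z ^ 2 + ψ z),
    (contDiff_const.mul (Complex.reCLM.contDiff.comp (contDiff_levi hρ hN hN))).div
      (((contDiff_gradSq hρ).pow 2).add hψ) hden, fun z hz => ?_⟩
  have hsm : cNormal n ρ z
      = ((2 / gradSq n ρ z : ℝ) : ℂ) • fun j => wDzbar n (cplx n ρ) j z := rfl
  rw [hsm, levi_smul_left, levi_smul_right hρ, Complex.conj_ofReal, Complex.re_ofReal_mul,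
    Complex.re_ofReal_mul]
  have := hg z hz
  simp only [hzero hz, add_zero]
  field_simp
  ring

end Levi

lemma IsDefining.mul_exp {n : ℕ} {Ω : Set (Fin n → ℂ)} {ρ a : (Fin n → ℂ) → ℝ}
    (hρ : IsDefining n Ω ρ) (ha : ContDiff ℝ (⊤ : ℕ∞) a) :
    IsDefining n Ω (fun z => ρ z * Real.exp (a z * ρ z)) := by
  obtain ⟨hs, U, hU, hcl, hneg, hzero, hgrad⟩ := hρ
  have hE : ContDiff ℝ (⊤ : ℕ∞) fun z => Real.exp (a z * ρ z) := (ha.mul hs).exp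
  refine ⟨hs.mul hE, U, hU, hcl, ?_, ?_, fun z hz => ?_⟩
  · rw [hneg]
    ext z
    simp [mul_neg_iff, Real.exp_pos, (Real.exp_pos _).not_gt]
  · rw [hzero]
    ext z
    simp
  · have hz0 : ρ z = 0 := by
      rw [hzero] at hz
      exact hz.2
    rw [fderiv_fun_mul (hs.differentiable (by simp)).differentiableAt
      (hE.differentiable (by simp)).differentiableAt, hz0]
    simpa using hgrad z hz

/-- if the complex Hessian of a defining function `ρ` of a smooth bounded
pseudoconvex domain is positive semidefinite on the span of the Levi null space `N(P)`
and the complex normal `L_n(P)` for every `P` in a compact `K ⊆ bΩ`, then there is a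
smooth defining function `ρ̃` whose complex Hessian vanishes identically on that span
at every point of `K`. -/
theorem exists_defining_hessian_zero_on_span (n : ℕ) (Ω : Set (Fin n → ℂ))
    (hΩ : Bornology.IsBounded Ω) (ρ : (Fin n → ℂ) → ℝ)
    (hρ : IsDefining n Ω ρ) (hpsc : Pseudoconvex n Ω ρ)
    (K : Set (Fin n → ℂ)) (hK : K ⊆ frontier Ω) (hKc : IsCompact K)
    (hsemi : ∀ P ∈ K, ∀ w ∈ nullNormalSpan n ρ P, 0 ≤ (levi n ρ P w w).re) :
    ∃ ρ' : (Fin n → ℂ) → ℝ, IsDefining n Ω ρ' ∧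
      ∀ P ∈ K, ∀ ζ ∈ nullNormalSpan n ρ P, ∀ w ∈ nullNormalSpan n ρ P,
        levi n ρ' P ζ w = 0 := by
  have hs := hρ.1
  have hdiff (z : Fin n → ℂ) : DifferentiableAt ℝ ρ z :=
    (hs.differentiable (by simp)).differentiableAt
  obtain ⟨_, U, -, -, -, hzero, hgrad⟩ := id hρ
  have hg (z) (hz : z ∈ frontier Ω) : gradSq n ρ z ≠ 0 := (gradSq_pos (hdiff z) (hgrad z hz)).ne'
  obtain ⟨a, ha, haF⟩ := exists_contDiff_eq_levi_cNormal hs isClosed_frontier hg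
  have hρ' := hρ.mul_exp ha
  refine ⟨_, hρ', fun P hP => ?_⟩
  have hPF := hK hP
  have hP0 : ρ P = 0 := by
    rw [hzero] at hPF
    exact hPF.2
  have hsub : leviNull n ρ P ∪ {cNormal n ρ P} ⊆ nullNormalSpan n ρ P := Submodule.subset_span
  have hnull {ζ w : Fin n → ℂ} (hζ : ζ ∈ leviNull n ρ P) (hw : w ∈ nullNormalSpan n ρ P) :
      levi n (fun z => ρ z * Real.exp (a z * ρ z)) P ζ w = 0 := by
    have hζ0 : ∑ j, ζ j * wDz n (cplx n ρ) j P = 0 := hζ.1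
    rw [levi_mul_exp hs ha hP0, hζ0,
      levi_eq_zero_of_self_eq_zero hs (hsemi P hP) (hsub (Or.inl hζ)) hw hζ.2]
    simp
  have hnormal : levi n (fun z => ρ z * Real.exp (a z * ρ z)) P (cNormal n ρ P)
      (cNormal n ρ P) = 0 := by
    rw [levi_mul_exp hs ha hP0, sum_cNormal_mul_wDz (hdiff P) (hg P hPF), haF P hPF,
      levi_self_eq_re hs]
    simp only [map_div₀, map_one, map_ofNat, Complex.ofReal_re]
    push_cast
    ring
  intro ζ hζ w hw
  induction hζ, hw using Submodule.span_induction₂ with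
  | mem_mem x y hx hy =>
    rcases hx with hx | rfl
    · exact hnull hx (hsub hy)
    · rcases hy with hy | rfl
      · rw [← conj_levi hρ'.1, hnull hy (hsub (Or.inr rfl)), map_zero]
      · exact hnormal
  | zero_left y hy => simp [levi]
  | zero_right x hx => simp [levi]
  | add_left x y z _ _ _ h1 h2 => rw [levi_add_left, h1, h2, add_zero]
  | add_right x y z _ _ _ h1 h2 => rw [levi_add_right hρ'.1, h1, h2, add_zero]
  | smul_left c x y _ _ h => rw [levi_smul_left, h, mul_zero]
  | smul_right c x y _ _ h => rw [levi_smul_right hρ'.1, h, mul_zero]
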